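/- Let H be a finite-dimensional Hopf algebra over a field and F ∈ H ⊗ H a 2-cocycle, with twisted Hopf algebra H_F. For any pair of coprime integers n, k with n > 1, the shuffled Frobenius–Schur indicator is gauge invariant: ν̃_{n,k}(H_F) = ν̃_{n,k}(H), where ν̃_{n,k}(H) = Tr(S ∘ P̃^{(n,k)}) with P̃^{(n,k)} = m ∘ σ_{(n,k)} ∘ Δ^{n−1} and σ_{(n,k)}(i) = ik mod n. -/

import Mathlib

/-!
STATEMENT 13:
Gauge invariance of the shuffled Frobenius–Schur indicator:  for a finite-dimensional
Hopf algebra H over a field, a 2-cocycle F of H and coprime integers n, l with n > 1,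
  ν̃_{n,l}(H_F) = ν̃_{n,l}(H),
where ν̃_{n,l}(H) = Tr(S ∘ P̃^{(n,l)}), P̃^{(n,l)} = m ∘ σ_{(n,l)} ∘ Δ^{n-1} with
σ_{(n,l)}(i) = il mod n (least positive residues), and ν̃_{n,l}(H_F) = Tr(S_F ∘ P̃_F^{(n,l)})
is the corresponding quantity for the Drinfeld twist H_F (same multiplication as H,
comultiplication Δ_F = FΔ(−)F⁻¹, antipode S_F = uS(−)u⁻¹).
The maps P̃^{(n,l)} and P̃_F^{(n,l)} are characterized by their values on finite-sum
representations of the (n-1)-fold (twisted) comultiplications.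
-/

open TensorProduct

structure AlgBundle (k : Type) [CommRing k] where
  carrier : Type
  ring : Ring carrier
  alg : @Algebra k carrier _ ring.toSemiring

section
variable (k H : Type) [Field k] [Ring H] [HopfAlgebra k H]

noncomputable def tpowB : ℕ → AlgBundle k
  | 0 => ⟨H, inferInstance, inferInstance⟩
  | n + 1 =>
      letI := (tpowB n).ring
      letI := (tpowB n).alg
      ⟨TensorProduct k H (tpowB n).carrier, inferInstance, inferInstance⟩

/-- `Tpow k H n` is the (n+1)-fold tensor power `H ⊗ (H ⊗ (⋯ ⊗ H))`. -/
noncomputable def Tpow (n : ℕ) : Type := (tpowB k H n).carrier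

noncomputable instance instTpowRing (n : ℕ) : Ring (Tpow k H n) := (tpowB k H n).ring
noncomputable instance instTpowAlgebra (n : ℕ) : Algebra k (Tpow k H n) := (tpowB k H n).alg

/-- The iterated comultiplication `Δ^{n+1} : H → H^{⊗(n+1)}`. -/
noncomputable def comulIter : ∀ n : ℕ, H →ₗ[k] Tpow k H n
  | 0 => LinearMap.id
  | n + 1 =>
      show H →ₗ[k] TensorProduct k H (Tpow k H n) from
        (TensorProduct.map LinearMap.id (comulIter n)) ∘ₗ Coalgebra.comul

/-- The higher twists of `F`:  `Fseq F n = F_{n+1}`. -/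
noncomputable def Fseq (F : H ⊗[k] H) : ∀ n : ℕ, Tpow k H n
  | 0 => 1
  | n + 1 =>
      show TensorProduct k H (Tpow k H n) from
        ((1 : H) ⊗ₜ[k] Fseq F n) * (TensorProduct.map LinearMap.id (comulIter k H n) F)

/-- Cast between tensor powers of equal length. -/
noncomputable def tcast {a b : ℕ} (h : a = b) : Tpow k H a ≃ₗ[k] Tpow k H b :=
  h ▸ LinearEquiv.refl k (Tpow k H a)

/-- The canonical identification `H^{⊗(a+1)} ⊗ H^{⊗(b+1)} ≅ H^{⊗(a+b+2)}`. -/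
noncomputable def concEquiv : ∀ a b : ℕ, (Tpow k H a ⊗[k] Tpow k H b) ≃ₗ[k] Tpow k H (a + 1 + b)
  | 0, b =>
      (show (Tpow k H 0 ⊗[k] Tpow k H b) ≃ₗ[k] Tpow k H (b + 1) from
        LinearEquiv.refl k (Tpow k H 0 ⊗[k] Tpow k H b)).trans (tcast k H (by omega))
  | a + 1, b =>
      (show (Tpow k H (a+1) ⊗[k] Tpow k H b) ≃ₗ[k] H ⊗[k] (Tpow k H a ⊗[k] Tpow k H b) from
        TensorProduct.assoc k H (Tpow k H a) (Tpow k H b)).trans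
      ((TensorProduct.congr (LinearEquiv.refl k H) (concEquiv a b)).trans
        ((show (TensorProduct k H (Tpow k H (a + 1 + b))) ≃ₗ[k] Tpow k H (a + 1 + b + 1) from
            LinearEquiv.refl k _).trans (tcast k H (by omega))))


/-- The nested pure tensor `f 0 ⊗ f 1 ⊗ ⋯ ⊗ f n` of a tuple. -/
noncomputable def nest : ∀ n : ℕ, (Fin (n + 1) → H) → Tpow k H n
  | 0, f => f 0
  | n + 1, f =>
      show TensorProduct k H (Tpow k H n) from f 0 ⊗ₜ[k] nest n (fun i => f i.succ)

/-- The twisted comultiplication `Δ_F(h) = F Δ(h) F⁻¹`. -/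
noncomputable def comulF (F F' : H ⊗[k] H) : H →ₗ[k] H ⊗[k] H :=
  (LinearMap.mulRight k F') ∘ₗ (LinearMap.mulLeft k F) ∘ₗ Coalgebra.comul

/-- The iterated twisted comultiplication `Δ_F^{n+1}`. -/
noncomputable def comulIterF (F F' : H ⊗[k] H) : ∀ n : ℕ, H →ₗ[k] Tpow k H n
  | 0 => LinearMap.id
  | n + 1 =>
      show H →ₗ[k] TensorProduct k H (Tpow k H n) from
        (TensorProduct.map LinearMap.id (comulIterF F F' n)) ∘ₗ comulF k H F F'

end

noncomputable section FSI
variable {k H R : Type} [Field k] [Ring H] [HopfAlgebra k H] [Ring R] [Algebra k R]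

def cm (φ ψ : H →ₐ[k] R) : Prop := ∀ x y, Commute (φ x) (ψ y)

def eps (k H R : Type) [Field k] [Ring H] [HopfAlgebra k H] [Ring R] [Algebra k R] : H →ₐ[k] R :=
  (Algebra.ofId k R).comp (Bialgebra.counitAlgHom k H)

lemma eps_apply (x : H) : eps k H R x = algebraMap k R (Coalgebra.counit (R := k) x) := rfl

lemma cm_eps_left (φ : H →ₐ[k] R) : cm (eps k H R) φ := fun _ _ => Algebra.commutes _ _
lemma cm_eps_right (φ : H →ₐ[k] R) : cm φ (eps k H R) := fun _ _ => (Algebra.commutes _ _).symm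
lemma cm.symm {φ ψ : H →ₐ[k] R} (h : cm φ ψ) : cm ψ φ := fun x y => (h y x).symm

open Classical in
def ev (φ ψ : H →ₐ[k] R) : H ⊗[k] H →ₐ[k] R :=
  if h : cm φ ψ then Algebra.TensorProduct.lift φ ψ h
  else Algebra.TensorProduct.lift (eps k H R) (eps k H R) (cm_eps_left _)

lemma ev_tmul {φ ψ : H →ₐ[k] R} (h : cm φ ψ) (x y : H) : ev φ ψ (x ⊗ₜ y) = φ x * ψ y := by
  rw [ev, dif_pos h]; exact Algebra.TensorProduct.lift_tmul ..

def cv (φ ψ : H →ₐ[k] R) : H →ₐ[k] R := (ev φ ψ).comp (Bialgebra.comulAlgHom k H)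

lemma cv_apply (φ ψ : H →ₐ[k] R) (x : H) : cv φ ψ x = ev φ ψ (Coalgebra.comul (R := k) x) := rfl


/-- linear version -/
def le {M N : Type} [AddCommGroup M] [Module k M] [AddCommGroup N] [Module k N]
    (f : M →ₗ[k] R) (g : N →ₗ[k] R) : M ⊗[k] N →ₗ[k] R :=
  LinearMap.mul' k R ∘ₗ TensorProduct.map f g

@[simp] lemma le_tmul {M N : Type} [AddCommGroup M] [Module k M] [AddCommGroup N] [Module k N]
    (f : M →ₗ[k] R) (g : N →ₗ[k] R) (x : M) (y : N) : le f g (x ⊗ₜ y) = f x * g y := rfl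

lemma ev_eq_le {φ ψ : H →ₐ[k] R} (h : cm φ ψ) (X : H ⊗[k] H) :
    ev φ ψ X = le φ.toLinearMap ψ.toLinearMap X := by
  induction X with
  | zero => simp
  | tmul x y => simp [ev_tmul h]
  | add x y hx hy => simp [hx, hy]

/-- commuting with everything -/
lemma commute_ev {φ ψ : H →ₐ[k] R} (h : cm φ ψ) {r : R} (h1 : ∀ x, Commute r (φ x))
    (h2 : ∀ x, Commute r (ψ x)) (X : H ⊗[k] H) : Commute r (ev φ ψ X) := by
  induction X with
  | zero => simp
  | tmul x y => rw [ev_tmul h]; exact (h1 x).mul_right (h2 y)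
  | add x y hx hy => rw [map_add]; exact hx.add_right hy

lemma cm_cv_right {φ ψ χ : H →ₐ[k] R} (h : cm φ ψ) (h1 : cm χ φ) (h2 : cm χ ψ) : cm χ (cv φ ψ) :=
  fun x _ => commute_ev h (h1 x) (h2 x) _

open WithConv

lemma le_comul_conv (f g : H →ₗ[k] R) :
   toConv (le f g ∘ₗ Coalgebra.comul) = toConv f * toConv g := by
  rfl

lemma le_conv {f g f' : H →ₗ[k] R} (h : toConv f * toConv g = toConv f') (x : H) :
    le f g (Coalgebra.comul (R := k) x) = f' x := by
  have : le f g ∘ₗ Coalgebra.comul = f' := by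
    apply WithConv.toConv_injective; rw [le_comul_conv, h]
  exact DFunLike.congr_fun this x

abbrev cS (φ : H →ₐ[k] R) : H →ₗ[k] R := φ.toLinearMap ∘ₗ HopfAlgebra.antipode k

lemma conv_eps : toConv (eps k H R).toLinearMap = 1 := rfl

lemma conv_inv1 (φ : H →ₐ[k] R) : toConv φ.toLinearMap * toConv (cS φ) = 1 := by
  have := LinearMap.algHom_comp_convMul_distrib φ (toConv LinearMap.id)
    (toConv (HopfAlgebra.antipode k (A := H)))
  rw [LinearMap.id_mul_antipode] at this
  apply WithConv.ofConv_injective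
  refine this.symm.trans ?_
  ext x
  simp

lemma conv_inv2 (φ : H →ₐ[k] R) : toConv (cS φ) * toConv φ.toLinearMap = 1 := by
  have := LinearMap.algHom_comp_convMul_distrib φ
    (toConv (HopfAlgebra.antipode k (A := H))) (toConv LinearMap.id)
  rw [LinearMap.antipode_mul_id] at this
  apply WithConv.ofConv_injective
  refine this.symm.trans ?_
  ext x
  simp

lemma conv_cv {φ ψ : H →ₐ[k] R} (h : cm φ ψ) :
    toConv (cv φ ψ).toLinearMap = toConv φ.toLinearMap * toConv ψ.toLinearMap := by
  rw [← le_comul_conv]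
  congr 1
  ext x
  exact ev_eq_le h _

lemma conv_A {φ ψ : H →ₐ[k] R} (h : cm φ ψ) :
    toConv ψ.toLinearMap * toConv (cS (cv φ ψ)) = toConv (cS φ) := by
  have h1 := conv_inv1 (cv φ ψ)
  rw [conv_cv h, mul_assoc] at h1
  have h2 := congrArg (fun t => toConv (cS φ) * t) h1
  simp only [← mul_assoc, conv_inv2, one_mul, mul_one] at h2
  exact h2

lemma conv_B {φ ψ : H →ₐ[k] R} (h : cm φ ψ) :
    toConv (cS (cv φ ψ)) * toConv φ.toLinearMap = toConv (cS ψ) := by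
  have h1 := conv_inv2 (cv φ ψ)
  rw [conv_cv h, ← mul_assoc] at h1
  have h2 := congrArg (fun t => t * toConv (cS ψ)) h1
  simp only [mul_assoc, conv_inv1, one_mul, mul_one] at h2
  exact h2

lemma algHom_ext_conv {φ ψ : H →ₐ[k] R} (h : toConv φ.toLinearMap = toConv ψ.toLinearMap) :
    φ = ψ := by
  have := WithConv.toConv_injective h
  ext x
  exact DFunLike.congr_fun this x

lemma cv_assoc {φ ψ χ : H →ₐ[k] R} (h1 : cm φ ψ) (h2 : cm φ χ) (h3 : cm ψ χ) :
    cv φ (cv ψ χ) = cv (cv φ ψ) χ := by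
  apply algHom_ext_conv
  rw [conv_cv (cm_cv_right h3 h1 h2), conv_cv h3,
    conv_cv (cm_cv_right h1 h2.symm h3.symm).symm, conv_cv h1, mul_assoc]

lemma cv_eps_left (φ : H →ₐ[k] R) : cv (eps k H R) φ = φ := by
  apply algHom_ext_conv
  rw [conv_cv (cm_eps_left _), conv_eps, one_mul]

lemma cv_eps_right (φ : H →ₐ[k] R) : cv φ (eps k H R) = φ := by
  apply algHom_ext_conv
  rw [conv_cv (cm_eps_right _), conv_eps, mul_one]

/-- the data of a two-cocycle -/
structure Coc (F G : H ⊗[k] H) : Prop where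
  FG : F * G = 1
  GF : G * F = 1
  cu1 : (TensorProduct.lid k H)
      ((TensorProduct.map (Coalgebra.counit (R := k)) LinearMap.id) F) = 1
  cu2 : (TensorProduct.rid k H)
      ((TensorProduct.map LinearMap.id (Coalgebra.counit (R := k))) F) = 1
  coc : ((1 : H) ⊗ₜ[k] F) *
        (TensorProduct.map LinearMap.id (Coalgebra.comul (R := k)) F) =
      (TensorProduct.assoc k H H H)
        ((F ⊗ₜ[k] (1 : H)) *
          (TensorProduct.map (Coalgebra.comul (R := k)) LinearMap.id F))

def dR (k H : Type) [Field k] [Ring H] [HopfAlgebra k H] : H ⊗[k] H →ₐ[k] H ⊗[k] (H ⊗[k] H) :=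
  Algebra.TensorProduct.map (AlgHom.id k H) (Bialgebra.comulAlgHom k H)
def dL (k H : Type) [Field k] [Ring H] [HopfAlgebra k H] : H ⊗[k] H →ₐ[k] (H ⊗[k] H) ⊗[k] H :=
  Algebra.TensorProduct.map (Bialgebra.comulAlgHom k H) (AlgHom.id k H)
def assocT (k H : Type) [Field k] [Ring H] [HopfAlgebra k H] :
    (H ⊗[k] H) ⊗[k] H →ₐ[k] H ⊗[k] (H ⊗[k] H) :=
  (Algebra.TensorProduct.assoc k k k H H H).toAlgHom
def iR (k H : Type) [Field k] [Ring H] [HopfAlgebra k H] : H ⊗[k] H →ₐ[k] H ⊗[k] (H ⊗[k] H) :=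
  Algebra.TensorProduct.includeRight
def iL (k H : Type) [Field k] [Ring H] [HopfAlgebra k H] : H ⊗[k] H →ₐ[k] (H ⊗[k] H) ⊗[k] H :=
  Algebra.TensorProduct.includeLeft

lemma Coc.coc' {F G : H ⊗[k] H} (c : Coc F G) :
    iR k H F * dR k H F = assocT k H (iL k H F * dL k H F) := c.coc

lemma Coc.cocG {F G : H ⊗[k] H} (c : Coc F G) :
    dR k H G * iR k H G = assocT k H (dL k H G * iL k H G) := by
  have e1 : (dR k H G * iR k H G) * (iR k H F * dR k H F) = 1 := by
    rw [mul_assoc, ← mul_assoc (iR k H G), ← map_mul, c.GF, map_one, one_mul, ← map_mul, c.GF,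
      map_one]
  have e2 : (iL k H F * dL k H F) * (dL k H G * iL k H G) = 1 := by
    rw [mul_assoc, ← mul_assoc (dL k H F), ← map_mul, c.FG, map_one, one_mul, ← map_mul, c.FG,
      map_one]
  have e3 := congrArg (assocT k H) e2
  rw [map_mul, map_one, ← c.coc'] at e3
  exact left_inv_eq_right_inv e1 e3

lemma Coc.ev_eps_left {F G : H ⊗[k] H} (c : Coc F G) (φ : H →ₐ[k] R) : ev (eps k H R) φ F = 1 := by
  have h : ∀ X : H ⊗[k] H, ev (eps k H R) φ X = φ ((TensorProduct.lid k H)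
      ((TensorProduct.map (Coalgebra.counit (R := k)) LinearMap.id) X)) := by
    intro X
    induction X with
    | zero => simp
    | tmul x y => simp [ev_tmul (cm_eps_left _), eps_apply, Algebra.smul_def]
    | add x y hx hy => simp only [map_add, hx, hy]
  rw [h, c.cu1, map_one]

lemma Coc.ev_eps_right {F G : H ⊗[k] H} (c : Coc F G) (φ : H →ₐ[k] R) : ev φ (eps k H R) F = 1 := by
  have h : ∀ X : H ⊗[k] H, ev φ (eps k H R) X = φ ((TensorProduct.rid k H)
      ((TensorProduct.map LinearMap.id (Coalgebra.counit (R := k))) X)) := by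
    intro X
    induction X with
    | zero => simp
    | tmul x y =>
      simp [ev_tmul (cm_eps_right _), eps_apply, Algebra.smul_def, Algebra.commutes]
    | add x y hx hy => simp only [map_add, hx, hy]
  rw [h, c.cu2, map_one]

lemma Coc.ev_eps_left' {F G : H ⊗[k] H} (c : Coc F G) (φ : H →ₐ[k] R) :
    ev (eps k H R) φ G = 1 := by
  have := congrArg (ev (eps k H R) φ) c.FG
  rwa [map_mul, c.ev_eps_left, one_mul, map_one] at this

lemma Coc.ev_eps_right' {F G : H ⊗[k] H} (c : Coc F G) (φ : H →ₐ[k] R) :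
    ev φ (eps k H R) G = 1 := by
  have := congrArg (ev φ (eps k H R)) c.FG
  rwa [map_mul, c.ev_eps_right, one_mul, map_one] at this

/-- cocycle identity in R -/
lemma Coc.tri {F G : H ⊗[k] H} (c : Coc F G) {φ ψ χ : H →ₐ[k] R} (h1 : cm φ ψ) (h2 : cm φ χ)
    (h3 : cm ψ χ) :
    ev ψ χ F * ev φ (cv ψ χ) F = ev φ ψ F * ev (cv φ ψ) χ F := by
  have h4 := cm_cv_right h3 h1 h2
  have h5 := (cm_cv_right h1 h2.symm h3.symm).symm
  let T : H ⊗[k] (H ⊗[k] H) →ₐ[k] R := Algebra.TensorProduct.lift φ (ev ψ χ)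
    (fun x y => commute_ev h3 (h1 x) (h2 x) y)
  have hT : ∀ x y, T (x ⊗ₜ y) = φ x * ev ψ χ y := fun x y => Algebra.TensorProduct.lift_tmul ..
  have t1 : T.comp (iR k H) = ev ψ χ := by
    ext x <;> simp [iR, hT]
  have t2 : T.comp (dR k H) = ev φ (cv ψ χ) := by
    ext x <;> simp [dR, hT, ev_tmul h4, cv_apply]
  have t3 : (T.comp (assocT k H)).comp (iL k H) = ev φ ψ := by
    ext x <;> simp [assocT, iL, hT, ev_tmul h1, Algebra.TensorProduct.one_def, ev_tmul h3]
  have t30 : ∀ (X : H ⊗[k] H) (y : H), T (assocT k H (X ⊗ₜ y)) = ev φ ψ X * χ y := by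
    intro X y
    have : X ⊗ₜ[k] y = iL k H X * ((1 : H ⊗[k] H) ⊗ₜ y) := by simp [iL]
    rw [this, map_mul, map_mul]
    have e := DFunLike.congr_fun t3 X
    simp only [AlgHom.comp_apply] at e
    rw [e]
    congr 1
    simp [assocT, hT, Algebra.TensorProduct.one_def, ev_tmul h3]
  have t4 : (T.comp (assocT k H)).comp (dL k H) = ev (cv φ ψ) χ := by
    ext x <;> simp [dL, t30, ev_tmul h5, cv_apply]
  have := congrArg T c.coc'
  rw [map_mul, map_mul, map_mul] at this
  rw [← t1, ← t2, ← t3, ← t4]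
  exact this

def uu (F : H ⊗[k] H) : H := le LinearMap.id (HopfAlgebra.antipode k) F
def vv (G : H ⊗[k] H) : H := le (HopfAlgebra.antipode k) LinearMap.id G

lemma anti_mul (x y : H) : HopfAlgebra.antipode k (x * y) =
    HopfAlgebra.antipode k y * HopfAlgebra.antipode k x :=
  HopfAlgebra.antipode_mul_antidistrib x y

/-- a bilinear-in-`X`,`Y` extension principle -/
lemma tensor_ext2 {M : Type} [AddCommGroup M] [Module k M]
    (f g : H ⊗[k] H →ₗ[k] H ⊗[k] H →ₗ[k] M)
    (h : ∀ a b c d, f (a ⊗ₜ b) (c ⊗ₜ d) = g (a ⊗ₜ b) (c ⊗ₜ d)) (X Y : H ⊗[k] H) :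
    f X Y = g X Y := by
  have : f = g := by
    ext a b c d
    exact h a b c d
  rw [this]

lemma le_cS_mul {φ χ : H →ₐ[k] R} (x1 x2 : H) (Y : H ⊗[k] H) :
    le φ.toLinearMap (cS χ) ((x1 ⊗ₜ x2) * Y) =
      φ x1 * le φ.toLinearMap (cS χ) Y * χ (HopfAlgebra.antipode k x2) := by
  induction Y with
  | zero => simp
  | tmul a b => simp [anti_mul, mul_assoc]
  | add a b ha hb => simp only [mul_add, map_add, ha, hb, add_mul]

lemma le_cS_mul' {φ χ : H →ₐ[k] R} (x1 x2 : H) (Y : H ⊗[k] H) :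
    le (cS χ) φ.toLinearMap (Y * (x1 ⊗ₜ x2)) =
      χ (HopfAlgebra.antipode k x1) * le (cS χ) φ.toLinearMap Y * φ x2 := by
  induction Y with
  | zero => simp
  | tmul a b => simp [anti_mul, mul_assoc]
  | add a b ha hb => simp only [mul_add, map_add, ha, hb, add_mul]

lemma map_uu (φ : H →ₐ[k] R) (F : H ⊗[k] H) : φ (uu F) = le φ.toLinearMap (cS φ) F := by
  unfold uu
  induction F with
  | zero => simp
  | tmul a b => simp
  | add a b ha hb => simp only [map_add, ha, hb]

lemma map_vv (φ : H →ₐ[k] R) (F : H ⊗[k] H) : φ (vv F) = le (cS φ) φ.toLinearMap F := by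
  unfold vv
  induction F with
  | zero => simp
  | tmul a b => simp
  | add a b ha hb => simp only [map_add, ha, hb]

lemma Coc.L4 {F G : H ⊗[k] H} (c : Coc F G) {φ ψ : H →ₐ[k] R} (h : cm φ ψ) :
    ev φ ψ F * cv φ ψ (uu F) = φ (uu F) * le ψ.toLinearMap (cS (cv φ ψ)) F := by
  set D := cv φ ψ with hD
  let Q : H ⊗[k] (H ⊗[k] H) →ₗ[k] R := le φ.toLinearMap (le ψ.toLinearMap (cS D))
  have hQ : ∀ (X : H ⊗[k] H) (y : H), Q (assocT k H (X ⊗ₜ y)) =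
      ev φ ψ X * D (HopfAlgebra.antipode k y) := by
    intro X y
    induction X with
    | zero => simp
    | tmul a b => simp [assocT, Q, ev_tmul h, mul_assoc]
    | add a b ha hb => simp only [TensorProduct.add_tmul, map_add, ha, hb, add_mul]
  have s1 : ∀ X Y : H ⊗[k] H, Q (assocT k H (iL k H X * dL k H Y)) =
      ev φ ψ X * le D.toLinearMap (cS D) Y := by
    intro X Y
    induction Y with
    | zero => simp
    | tmul a b =>
      simp [dL, iL, hQ, D, cv_apply, mul_assoc]
    | add a b ha hb => simp only [map_add, ha, hb, mul_add]
  have s2 : ∀ X Y : H ⊗[k] H, Q (iR k H X * dR k H Y) =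
      le φ.toLinearMap (cS φ) Y * le ψ.toLinearMap (cS D) X := by
    intro X Y
    induction X with
    | zero => simp
    | add a b ha hb => simp only [map_add, ha, hb, mul_add, add_mul]
    | tmul x1 x2 =>
      induction Y with
      | zero => simp
      | add a b ha hb => simp only [map_add, ha, hb, mul_add, add_mul]
      | tmul y1 y2 =>
        have e := le_conv (conv_A h) y2
        simp only [dR, iR, Q, Algebra.TensorProduct.map_tmul,
          Algebra.TensorProduct.includeRight_apply, Algebra.TensorProduct.tmul_mul_tmul, one_mul,
          le_tmul, le_cS_mul, AlgHom.id_apply, Bialgebra.comulAlgHom_apply]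
        rw [← hD] at e
        rw [e]
        have e2 := (h (HopfAlgebra.antipode k y2) x1).eq
        simp only [AlgHom.toLinearMap_apply, LinearMap.comp_apply]
        rw [← e2]
        simp only [mul_assoc]
  have := congrArg Q c.coc'
  rw [s1, s2] at this
  rw [map_uu, map_uu, ← this]

lemma Coc.L4' {F G : H ⊗[k] H} (c : Coc F G) {φ ψ : H →ₐ[k] R} (h : cm φ ψ) :
    cv φ ψ (vv G) * ev φ ψ G = le (cS (cv φ ψ)) φ.toLinearMap G * ψ (vv G) := by
  set D := cv φ ψ with hD
  let Q : H ⊗[k] (H ⊗[k] H) →ₗ[k] R := le (cS D) (le φ.toLinearMap ψ.toLinearMap)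
  have hQ : ∀ (X : H ⊗[k] H) (y : H), Q (assocT k H (X ⊗ₜ y)) =
      le (cS D) φ.toLinearMap X * ψ y := by
    intro X y
    induction X with
    | zero => simp
    | tmul a b => simp [assocT, Q, mul_assoc]
    | add a b ha hb => simp only [TensorProduct.add_tmul, map_add, ha, hb, add_mul]
  have s1 : ∀ X Y : H ⊗[k] H, Q (dR k H Y * iR k H X) =
      le (cS D) D.toLinearMap Y * ev φ ψ X := by
    intro X Y
    induction Y with
    | zero => simp
    | tmul a b =>
      simp [dR, iR, Q, D, cv_apply, mul_assoc, ← ev_eq_le h]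
    | add a b ha hb => simp only [map_add, ha, hb, add_mul]
  have s2 : ∀ X Y : H ⊗[k] H, Q (assocT k H (dL k H Y * iL k H X)) =
      le (cS D) φ.toLinearMap X * le (cS ψ) ψ.toLinearMap Y := by
    intro X Y
    induction X with
    | zero => simp
    | add a b ha hb => simp only [map_add, ha, hb, mul_add, add_mul]
    | tmul x1 x2 =>
      induction Y with
      | zero => simp
      | add a b ha hb => simp only [map_add, ha, hb, mul_add, add_mul]
      | tmul y1 y2 =>
        have e := le_conv (conv_B h) y1
        simp only [dL, iL, Algebra.TensorProduct.map_tmul,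
          Algebra.TensorProduct.includeLeft_apply, Algebra.TensorProduct.tmul_mul_tmul, mul_one,
          le_tmul, hQ, le_cS_mul', AlgHom.id_apply, Bialgebra.comulAlgHom_apply]
        rw [← hD] at e
        rw [e]
        have e2 := (h x2 (HopfAlgebra.antipode k y1)).eq
        simp only [AlgHom.toLinearMap_apply, LinearMap.comp_apply]
        rw [mul_assoc (D _), ← e2]
        simp only [mul_assoc]
  have := congrArg Q c.cocG
  rw [s1, s2] at this
  rw [map_vv, map_vv, ← this]

lemma Coc.mixed {F G : H ⊗[k] H} (c : Coc F G) :
    iR k H G * assocT k H (iL k H F) = dR k H F * assocT k H (dL k H G) := by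
  have h := c.coc'
  rw [map_mul] at h
  have e1 : iR k H G * iR k H F = 1 := by rw [← map_mul, c.GF, map_one]
  have e2 : assocT k H (dL k H F) * assocT k H (dL k H G) = 1 := by
    rw [← map_mul, ← map_mul, c.FG, map_one, map_one]
  calc _ = iR k H G * (assocT k H (iL k H F) * assocT k H (dL k H F)) * assocT k H (dL k H G) := by
        rw [mul_assoc, mul_assoc, e2, mul_one]
    _ = _ := by rw [← h, ← mul_assoc, e1, one_mul]

lemma le_anti_mul (y1 y2 : H) (Y : H ⊗[k] H) :
    le (HopfAlgebra.antipode k) LinearMap.id (Y * (y1 ⊗ₜ y2)) =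
      HopfAlgebra.antipode k y1 * le (HopfAlgebra.antipode k) LinearMap.id Y * y2 := by
  induction Y with
  | zero => simp
  | tmul a b => simp [anti_mul, mul_assoc]
  | add a b ha hb => simp only [mul_add, map_add, ha, hb, add_mul]

lemma Coc.uv {F G : H ⊗[k] H} (c : Coc F G) : uu F * vv G = 1 := by
  let Q : H ⊗[k] (H ⊗[k] H) →ₗ[k] H :=
    le LinearMap.id (le (HopfAlgebra.antipode k) LinearMap.id)
  have s1 : ∀ X Y : H ⊗[k] H, Q (iR k H Y * assocT k H (iL k H X)) = uu X * vv Y := by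
    intro X Y
    unfold uu vv
    induction X with
    | zero => simp
    | add a b ha hb => simp only [map_add, ha, hb, mul_add, add_mul]
    | tmul x1 x2 =>
      induction Y with
      | zero => simp
      | add a b ha hb => simp only [map_add, ha, hb, mul_add, add_mul]
      | tmul y1 y2 => simp [iR, iL, assocT, Q, anti_mul, mul_assoc]
  have q1 : ∀ (y : H) (Z : H ⊗[k] H) (z : H) (x2 : H), Q (assocT k H (Z ⊗ₜ z)) =
      le LinearMap.id (HopfAlgebra.antipode k) Z * z := by
    intro y Z z x2
    induction Z with
    | zero => simp
    | add a b ha hb => simp only [TensorProduct.add_tmul, map_add, ha, hb, add_mul]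
    | tmul y1 y2 => simp [assocT, Q, mul_assoc]
  have s3 : ∀ (x1 x2 : H) (W : H ⊗[k] (H ⊗[k] H)), Q (dR k H (x1 ⊗ₜ x2) * W) =
      Coalgebra.counit (R := k) x2 • (x1 * Q W) := by
    intro x1 x2 W
    induction W with
    | zero => simp
    | add a b ha hb => simp only [map_add, ha, hb, mul_add, smul_add]
    | tmul a W =>
      induction W with
      | zero => simp
      | add x y hx hy => simp only [TensorProduct.tmul_add, map_add, hx, hy, mul_add, smul_add]
      | tmul y1 y2 =>
        have e : le (HopfAlgebra.antipode k) LinearMap.id (Coalgebra.comul (R := k) x2) =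
            algebraMap k H (Coalgebra.counit x2) := HopfAlgebra.mul_antipode_rTensor_comul_apply x2
        simp only [dR, Q, Algebra.TensorProduct.map_tmul,
          Algebra.TensorProduct.tmul_mul_tmul,
          le_tmul, le_anti_mul, AlgHom.id_apply, Bialgebra.comulAlgHom_apply, e]
        simp only [Algebra.algebraMap_eq_smul_one, LinearMap.id_apply, mul_smul_comm, smul_mul_assoc,
          mul_one, mul_assoc]
  have s4 : ∀ X W, Q (dR k H X * W) = (TensorProduct.rid k H)
      ((TensorProduct.map LinearMap.id (Coalgebra.counit (R := k))) X) * Q W := by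
    intro X W
    induction X with
    | zero => simp
    | add a b ha hb => simp only [map_add, ha, hb, add_mul]
    | tmul x1 x2 => rw [s3]; simp
  have s5 : ∀ X, Q (assocT k H (dL k H X)) = ev (eps k H H) (AlgHom.id k H) X := by
    intro X
    induction X with
    | zero => simp
    | add a b ha hb => simp only [map_add, ha, hb]
    | tmul x1 x2 =>
      have e : le LinearMap.id (HopfAlgebra.antipode k) (Coalgebra.comul (R := k) x1) =
            algebraMap k H (Coalgebra.counit x1) := HopfAlgebra.mul_antipode_lTensor_comul_apply x1
      rw [ev_tmul (cm_eps_left _)]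
      simp only [dL, Algebra.TensorProduct.map_tmul, q1 1 _ _ 1, Bialgebra.comulAlgHom_apply, e]
      rfl
  rw [← s1, c.mixed, s4, c.cu2, s5, c.ev_eps_left', one_mul]

def DD : List (H →ₐ[k] R) → (H →ₐ[k] R)
  | [] => eps k H R
  | φ :: l => cv φ (DD l)

def FF (F : H ⊗[k] H) : List (H →ₐ[k] R) → R
  | [] => 1
  | φ :: l => FF F l * ev φ (DD l) F

def FI (G : H ⊗[k] H) : List (H →ₐ[k] R) → R
  | [] => 1
  | φ :: l => ev φ (DD l) G * FI G l

lemma cm_DD_aux (l : List (H →ₐ[k] R)) (hl : l.Pairwise cm) (χ : H →ₐ[k] R)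
    (h : ∀ ψ ∈ l, cm χ ψ) : cm χ (DD l) := by
  induction l generalizing χ with
  | nil => exact cm_eps_right _
  | cons φ l ih =>
    rw [List.pairwise_cons] at hl
    exact cm_cv_right (ih hl.2 φ hl.1) (h φ (by simp)) (ih hl.2 χ (fun ψ hψ => h ψ (by simp [hψ])))

lemma cm_DD {χ : H →ₐ[k] R} {l : List (H →ₐ[k] R)} (hl : l.Pairwise cm)
    (h : ∀ ψ ∈ l, cm χ ψ) : cm χ (DD l) := cm_DD_aux l hl χ h

lemma DD_commute {r : R} {l : List (H →ₐ[k] R)} (hl : l.Pairwise cm)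
    (h : ∀ ψ ∈ l, ∀ x, Commute r (ψ x)) (x : H) : Commute r (DD l x) := by
  induction l generalizing x with
  | nil => exact (Algebra.commutes _ _).symm
  | cons φ l ih =>
    rw [List.pairwise_cons] at hl
    exact commute_ev (cm_DD hl.2 hl.1) (h φ (by simp))
      (fun y => ih hl.2 (fun ψ hψ => h ψ (by simp [hψ])) y) _

lemma FF_commute (F : H ⊗[k] H) {r : R} {l : List (H →ₐ[k] R)} (hl : l.Pairwise cm)
    (h : ∀ ψ ∈ l, ∀ x, Commute r (ψ x)) : Commute r (FF F l) := by
  induction l with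
  | nil => exact Commute.one_right _
  | cons φ l ih =>
    rw [List.pairwise_cons] at hl
    have h' : ∀ ψ ∈ l, ∀ x, Commute r (ψ x) := (fun ψ hψ => h ψ (by simp [hψ]))
    exact (ih hl.2 h').mul_right (commute_ev (cm_DD hl.2 hl.1) (h φ (by simp))
      (fun y => DD_commute hl.2 h' y) _)

lemma FI_commute (F : H ⊗[k] H) {r : R} {l : List (H →ₐ[k] R)} (hl : l.Pairwise cm)
    (h : ∀ ψ ∈ l, ∀ x, Commute r (ψ x)) : Commute r (FI F l) := by
  induction l with
  | nil => exact Commute.one_right _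
  | cons φ l ih =>
    rw [List.pairwise_cons] at hl
    have h' : ∀ ψ ∈ l, ∀ x, Commute r (ψ x) := (fun ψ hψ => h ψ (by simp [hψ]))
    exact (commute_ev (cm_DD hl.2 hl.1) (h φ (by simp))
      (fun y => DD_commute hl.2 h' y) _).mul_right (ih hl.2 h')

lemma cm_DD_DD {l₁ l₂ : List (H →ₐ[k] R)} (hl : (l₁ ++ l₂).Pairwise cm) :
    cm (DD l₁) (DD l₂) := by
  rw [List.pairwise_append] at hl
  obtain ⟨h1, h2, h3⟩ := hl
  exact (cm_DD h1 (fun ψ hψ => (cm_DD h2 (h3 ψ hψ)).symm)).symm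

lemma DD_append {l₁ l₂ : List (H →ₐ[k] R)} (hl : (l₁ ++ l₂).Pairwise cm) :
    DD (l₁ ++ l₂) = cv (DD l₁) (DD l₂) := by
  induction l₁ with
  | nil => exact (cv_eps_left _).symm
  | cons φ l ih =>
    rw [List.cons_append, List.pairwise_cons] at hl
    have h0 := cm_DD_DD hl.2
    rw [List.cons_append, DD, ih hl.2, DD]
    have hl2 := List.pairwise_append.1 hl.2
    exact cv_assoc (cm_DD hl2.1 (fun ψ hψ => hl.1 ψ (by simp [hψ])))
      (cm_DD hl2.2.1 (fun ψ hψ => hl.1 ψ (by simp [hψ]))) h0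

lemma Coc.FF_append {F G : H ⊗[k] H} (c : Coc F G) {l₁ l₂ : List (H →ₐ[k] R)}
    (hl : (l₁ ++ l₂).Pairwise cm) :
    FF F (l₁ ++ l₂) = FF F l₁ * FF F l₂ * ev (DD l₁) (DD l₂) F := by
  induction l₁ with
  | nil => simp [FF, DD, c.ev_eps_left]
  | cons φ l ih =>
    have hl0 := hl
    rw [List.cons_append, List.pairwise_cons] at hl
    have h0 := cm_DD_DD hl.2
    have hl2 := List.pairwise_append.1 hl.2
    have hl3 := List.pairwise_append.1 hl0
    have h1 := (cm_DD hl2.1 (fun ψ hψ => hl.1 ψ (by simp [hψ])))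
    have h2 := (cm_DD hl2.2.1 (fun ψ hψ => hl.1 ψ (by simp [hψ])))
    rw [List.cons_append, FF, ih hl.2, DD_append hl.2, DD, FF, mul_assoc, c.tri h1 h2 h0]
    have e : Commute (ev φ (DD l) F) (FF F l₂) := by
      apply FF_commute F hl2.2.1
      intro ψ hψ x
      refine (commute_ev h1 (fun y => (hl.1 ψ (by simp [hψ]) y x).symm) (fun y => ?_) _).symm
      exact DD_commute hl2.1 (fun χ hχ z => (hl2.2.2 χ hχ ψ hψ z x).symm) y
    simp only [mul_assoc]
    rw [← mul_assoc (FF F l₂), ← e.eq, mul_assoc]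

lemma Coc.FF_FI {F G : H ⊗[k] H} (c : Coc F G) (l : List (H →ₐ[k] R)) :
    FF F l * FI G l = 1 := by
  induction l with
  | nil => simp [FF, FI]
  | cons φ l ih =>
    rw [FF, FI, mul_assoc, ← mul_assoc (ev _ _ _), ← map_mul, c.FG, map_one, one_mul, ih]

lemma Coc.FI_FF {F G : H ⊗[k] H} (c : Coc F G) (l : List (H →ₐ[k] R)) :
    FI G l * FF F l = 1 := by
  induction l with
  | nil => simp [FF, FI]
  | cons φ l ih =>
    rw [FF, FI, mul_assoc, ← mul_assoc (FI _ _), ih, one_mul, ← map_mul, c.GF, map_one]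

lemma Coc.FI_append {F G : H ⊗[k] H} (c : Coc F G) {l₁ l₂ : List (H →ₐ[k] R)}
    (hl : (l₁ ++ l₂).Pairwise cm) :
    FI G (l₁ ++ l₂) = ev (DD l₁) (DD l₂) G * FI G l₁ * FI G l₂ := by
  have hl2 := List.pairwise_append.1 hl
  have e : Commute (FF F l₁) (FF F l₂) := by
    apply FF_commute F hl2.2.1
    intro ψ hψ x
    exact (FF_commute F hl2.1 (fun χ hχ z => (hl2.2.2 χ hχ ψ hψ z x).symm)).symm
  refine left_inv_eq_right_inv (c.FI_FF _) ?_
  rw [c.FF_append hl]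
  calc _ = FF F l₁ * FF F l₂ * (ev (DD l₁) (DD l₂) F * ev (DD l₁) (DD l₂) G) *
        FI G l₁ * FI G l₂ := by simp only [mul_assoc]
    _ = 1 := by
      rw [← map_mul, c.FG, map_one, mul_one, e.eq, mul_assoc (FF F l₂), c.FF_FI, mul_one, c.FF_FI]

lemma ev_comp {R' : Type} [Ring R'] [Algebra k R'] (θ : R →ₐ[k] R') {φ ψ : H →ₐ[k] R}
    (h : cm φ ψ) : ev (θ.comp φ) (θ.comp ψ) = θ.comp (ev φ ψ) := by
  have h' : cm (θ.comp φ) (θ.comp ψ) := fun x y => (h x y).map θ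
  ext x <;> simp [ev_tmul h, ev_tmul h']

lemma cm.comp {R' : Type} [Ring R'] [Algebra k R'] (θ : R →ₐ[k] R') {φ ψ : H →ₐ[k] R}
    (h : cm φ ψ) : cm (θ.comp φ) (θ.comp ψ) := fun x y => (h x y).map θ

lemma pw_map {R' : Type} [Ring R'] [Algebra k R'] (θ : R →ₐ[k] R') {l : List (H →ₐ[k] R)}
    (hl : l.Pairwise cm) : (l.map θ.comp).Pairwise cm :=
  List.Pairwise.map _ (fun _ _ h => h.comp θ) hl

lemma DD_map {R' : Type} [Ring R'] [Algebra k R'] (θ : R →ₐ[k] R') {l : List (H →ₐ[k] R)}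
    (hl : l.Pairwise cm) : DD (l.map θ.comp) = θ.comp (DD l) := by
  induction l with
  | nil => ext x; simp [DD, eps_apply]
  | cons φ l ih =>
    rw [List.pairwise_cons] at hl
    rw [List.map_cons, DD, ih hl.2, DD, cv, ev_comp θ (cm_DD hl.2 hl.1)]
    rfl

lemma FF_map {R' : Type} [Ring R'] [Algebra k R'] (θ : R →ₐ[k] R') (F : H ⊗[k] H)
    {l : List (H →ₐ[k] R)}
    (hl : l.Pairwise cm) : FF F (l.map θ.comp) = θ (FF F l) := by
  induction l with
  | nil => simp [FF]
  | cons φ l ih =>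
    rw [List.pairwise_cons] at hl
    rw [List.map_cons, FF, ih hl.2, DD_map θ hl.2, ev_comp θ (cm_DD hl.2 hl.1), FF, map_mul]
    rfl

lemma FI_map {R' : Type} [Ring R'] [Algebra k R'] (θ : R →ₐ[k] R') (F : H ⊗[k] H)
    {l : List (H →ₐ[k] R)}
    (hl : l.Pairwise cm) : FI F (l.map θ.comp) = θ (FI F l) := by
  induction l with
  | nil => simp [FI]
  | cons φ l ih =>
    rw [List.pairwise_cons] at hl
    rw [List.map_cons, FI, ih hl.2, DD_map θ hl.2, ev_comp θ (cm_DD hl.2 hl.1), FI, map_mul]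
    rfl

lemma Coc.Aside {F G : H ⊗[k] H} (c : Coc F G) {l₁ l₂ : List (H →ₐ[k] R)}
    (hl : (l₁ ++ l₂).Pairwise cm) :
    FF F (l₁ ++ l₂) * DD (l₁ ++ l₂) (uu F) = FF F l₁ * DD l₁ (uu F) * FF F l₂ *
      le (DD l₂).toLinearMap (cS (DD (l₁ ++ l₂))) F := by
  have h0 := cm_DD_DD hl
  have hl2 := List.pairwise_append.1 hl
  have e : Commute (DD l₁ (uu F)) (FF F l₂) := by
    apply FF_commute F hl2.2.1
    intro ψ hψ x
    exact (DD_commute hl2.1 (fun χ hχ z => (hl2.2.2 χ hχ ψ hψ z x).symm) _).symm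
  rw [c.FF_append hl, DD_append hl, mul_assoc, c.L4 h0]
  simp only [mul_assoc]
  rw [← mul_assoc (FF F l₂), ← e.eq, mul_assoc]

lemma Coc.Bside {F G : H ⊗[k] H} (c : Coc F G) {l₁ l₂ : List (H →ₐ[k] R)}
    (hl : (l₁ ++ l₂).Pairwise cm) :
    DD (l₁ ++ l₂) (vv G) * FI G (l₁ ++ l₂) = le (cS (DD (l₁ ++ l₂))) (DD l₁).toLinearMap G *
      FI G l₁ * DD l₂ (vv G) * FI G l₂ := by
  have h0 := cm_DD_DD hl
  have hl2 := List.pairwise_append.1 hl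
  have e : Commute (DD l₂ (vv G)) (FI G l₁) := by
    apply FI_commute G hl2.1
    intro ψ hψ x
    exact (DD_commute hl2.2.1 (fun χ hχ z => (hl2.2.2 ψ hψ χ hχ x z)) _).symm
  rw [c.FI_append hl, DD_append hl, ← mul_assoc, ← mul_assoc, c.L4' h0]
  rw [mul_assoc _ (DD l₂ _), e.eq]
  simp only [mul_assoc]

lemma Coc.gapside {F G : H ⊗[k] H} (c : Coc F G) {g0 gN : H →ₐ[k] R}
    {l₁ l₂ C : List (H →ₐ[k] R)} (hE : g0 :: l₁ = l₂ ++ [gN])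
    (hp : (g0 :: l₁).Pairwise cm) (hvu : vv G * uu F = 1) :
    le g0.toLinearMap (DD l₁).toLinearMap G * FI G l₁ * DD C (vv G) * FI G C *
      (FF F C * DD C (uu F) * FF F l₂ * le (DD l₂).toLinearMap gN.toLinearMap F) = 1 := by
  have h1 : le g0.toLinearMap (DD l₁).toLinearMap G * FI G l₁ = FI G (g0 :: l₁) := by
    rw [List.pairwise_cons] at hp
    rw [FI, ev_eq_le (cm_DD hp.2 hp.1)]
  have h2 : FF F l₂ * le (DD l₂).toLinearMap gN.toLinearMap F = FF F (g0 :: l₁) := by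
    rw [hE] at hp ⊢
    rw [c.FF_append hp]
    have e1 : FF F [gN] = 1 := by simp [FF, DD, c.ev_eps_right]
    have e2 : DD [gN] = gN := by simp [DD, cv_eps_right]
    have e3 := cm_DD_DD hp
    rw [e2] at e3
    rw [e1, e2, mul_one, ev_eq_le e3]
  rw [h1]
  calc _ = FI G (g0 :: l₁) * DD C (vv G) * (FI G C * FF F C) * DD C (uu F) * (FF F l₂ *
       le (DD l₂).toLinearMap gN.toLinearMap F) := by simp only [mul_assoc]
    _ = 1 := by
      rw [h2, c.FI_FF, mul_one, mul_assoc (FI G _), ← map_mul, hvu, map_one, mul_one, c.FI_FF]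

section bridge
variable (k H)

def iRT (n : ℕ) : Tpow k H n →ₐ[k] Tpow k H (n + 1) :=
  show Tpow k H n →ₐ[k] H ⊗[k] Tpow k H n from Algebra.TensorProduct.includeRight

def iLT (n : ℕ) : H →ₐ[k] Tpow k H (n + 1) :=
  show H →ₐ[k] H ⊗[k] Tpow k H n from Algebra.TensorProduct.includeLeft

def tmulT (n : ℕ) (x : H) (y : Tpow k H n) : Tpow k H (n + 1) :=
  show H ⊗[k] Tpow k H n from x ⊗ₜ[k] y

def mapT (n : ℕ) (f : H →ₗ[k] Tpow k H n) : H ⊗[k] H →ₗ[k] Tpow k H (n + 1) :=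
  show H ⊗[k] H →ₗ[k] H ⊗[k] Tpow k H n from TensorProduct.map LinearMap.id f

lemma mapT_tmul (n : ℕ) (f : H →ₗ[k] Tpow k H n) (x y : H) :
    mapT k H n f (x ⊗ₜ y) = tmulT k H n x (f y) := rfl

lemma comulIter_succ (n : ℕ) (x : H) : comulIter k H (n + 1) x =
    mapT k H n (comulIter k H n) (Coalgebra.comul (R := k) x) := rfl

lemma comulIterF_succ (F G : H ⊗[k] H) (n : ℕ) (x : H) : comulIterF k H F G (n + 1) x =
    mapT k H n (comulIterF k H F G n) (F * Coalgebra.comul (R := k) x * G) := rfl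

lemma iL_mul_iR (n : ℕ) (x : H) (y : Tpow k H n) :
    iLT k H n x * iRT k H n y = tmulT k H n x y := by
  refine (Algebra.TensorProduct.tmul_mul_tmul (R := k) x (1 : H) (1 : Tpow k H n) y).trans ?_
  rw [one_mul, mul_one]; rfl

lemma iR_mul_iL (n : ℕ) (x : H) (y : Tpow k H n) :
    iRT k H n y * iLT k H n x = tmulT k H n x y := by
  refine (Algebra.TensorProduct.tmul_mul_tmul (R := k) (1 : H) x y (1 : Tpow k H n)).trans ?_
  rw [one_mul, mul_one]; rfl

def idT : H →ₐ[k] Tpow k H 0 := AlgHom.id k H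

def tl : ∀ n : ℕ, Fin (n + 1) → (H →ₐ[k] Tpow k H n)
  | 0, _ => idT k H
  | n + 1, i => Fin.cases (motive := fun _ => H →ₐ[k] Tpow k H (n+1))
      (iLT k H n) (fun j => (iRT k H n).comp (tl n j)) i

def legs (n : ℕ) : List (H →ₐ[k] Tpow k H n) := List.ofFn (tl k H n)

lemma legs_succ (n : ℕ) : legs k H (n + 1) = iLT k H n :: (legs k H n).map (iRT k H n).comp := by
  rw [legs, List.ofFn_succ, legs, List.map_ofFn]
  rfl

lemma legs_zero : legs k H 0 = [idT k H] := by
  rw [legs, List.ofFn_succ, List.ofFn_zero]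
  rfl

lemma cm_iLR (n : ℕ) (φ : H →ₐ[k] Tpow k H n) : cm (iLT k H n) ((iRT k H n).comp φ) := by
  intro x y
  exact (iL_mul_iR k H n x (φ y)).trans (iR_mul_iL k H n x (φ y)).symm

lemma legs_pw (n : ℕ) : (legs k H n).Pairwise cm := by
  induction n with
  | zero => rw [legs_zero]; exact List.pairwise_singleton _ _
  | succ n ih =>
    rw [legs_succ, List.pairwise_cons]
    refine ⟨?_, pw_map _ ih⟩
    intro a ha
    obtain ⟨b, _, rfl⟩ := List.mem_map.1 ha
    exact cm_iLR k H n b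

lemma map_eq_ev (n : ℕ) (φ : H →ₐ[k] Tpow k H n) (X : H ⊗[k] H) :
    mapT k H n φ.toLinearMap X = ev (iLT k H n) ((iRT k H n).comp φ) X := by
  induction X with
  | zero => rw [map_zero, map_zero]
  | tmul x y =>
    rw [ev_tmul (cm_iLR k H n φ), mapT_tmul, AlgHom.comp_apply, iL_mul_iR]; rfl
  | add x y hx hy => rw [map_add, map_add, hx, hy]

lemma DD_legs_succ (n : ℕ) : DD (legs k H (n+1)) =
    cv (iLT k H n) ((iRT k H n).comp (DD (legs k H n))) := by
  rw [legs_succ, DD, DD_map _ (legs_pw k H n)]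

lemma comulIter_eq (n : ℕ) : comulIter k H n = (DD (legs k H n)).toLinearMap := by
  induction n with
  | zero =>
    rw [legs_zero, DD, DD, cv_eps_right]; rfl
  | succ n ih =>
    ext x
    rw [DD_legs_succ, comulIter_succ, ih, map_eq_ev]
    rfl

variable {k H}
lemma comulIterF_eq {F G : H ⊗[k] H} (c : Coc F G) (n : ℕ) (x : H) : comulIterF k H F G n x =
    FF F (legs k H n) * DD (legs k H n) x * FI G (legs k H n) := by
  induction n generalizing x with
  | zero =>
    rw [legs_zero]
    simp only [FF, FI, DD, cv_eps_right, c.ev_eps_right, c.ev_eps_right', one_mul, mul_one]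
    rfl
  | succ n ih =>
    have key : ∀ X : H ⊗[k] H, mapT k H n (comulIterF k H F G n) X =
        iRT k H n (FF F (legs k H n)) * ev (iLT k H n) ((iRT k H n).comp (DD (legs k H n))) X
          * iRT k H n (FI G (legs k H n)) := by
      intro X
      induction X with
      | zero => rw [map_zero, map_zero, mul_zero, zero_mul]
      | tmul x y =>
        rw [ev_tmul (cm_iLR k H n _), mapT_tmul, ih y, ← iL_mul_iR, AlgHom.comp_apply, ← mul_assoc,
          iR_mul_iL, ← iL_mul_iR, map_mul, map_mul]
        simp only [mul_assoc]
      | add x y hx hy => rw [map_add, map_add, mul_add, add_mul, hx, hy]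
    rw [comulIterF_succ, key, DD_legs_succ, legs_succ, FF, FI, FF_map _ _ (legs_pw k H n),
      FI_map _ _ (legs_pw k H n), DD_map _ (legs_pw k H n), cv_apply, map_mul, map_mul]
    simp only [mul_assoc]

/-- plain tensor power -/
abbrev PT (k H : Type) [Field k] [Ring H] [HopfAlgebra k H] (m : ℕ) : Type := ⨂[k] _ : Fin m, H

variable (k H) in
abbrev tp {m : ℕ} : MultilinearMap k (fun _ : Fin m => H) (PT k H m) := PiTensorProduct.tprod k

variable (k H) in
def pl (m : ℕ) (i : Fin m) : H →ₐ[k] PT k H m := PiTensorProduct.singleAlgHom (R := k) (A := fun _ : Fin m => H) i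

lemma pl_apply (m : ℕ) (i : Fin m) (x : H) : pl k H m i x = tp k H (Pi.mulSingle i x) := rfl

variable (k H) in
def nestM (n : ℕ) : MultilinearMap k (fun _ : Fin (n + 1) => H) (Tpow k H n) :=
  (MultilinearMap.mkPiAlgebraFin k (n + 1) (Tpow k H n)).compLinearMap
    (fun i => (tl k H n i).toLinearMap)

lemma nest_succ (n : ℕ) (f : Fin (n + 2) → H) :
    nest k H (n + 1) f = tmulT k H n (f 0) (nest k H n fun i => f i.succ) := rfl

lemma nestM_apply (n : ℕ) (f : Fin (n + 1) → H) : nestM k H n f = nest k H n f := by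
  have h0 : ∀ f : Fin (n + 1) → H, nestM k H n f = (List.ofFn fun i => tl k H n i (f i)).prod := by
    intro f; simp [nestM]
  rw [h0]; clear h0
  induction n with
  | zero => rw [List.ofFn_succ, List.ofFn_zero, List.prod_singleton]; rfl
  | succ n ih =>
    rw [List.ofFn_succ, List.prod_cons, nest_succ, ← ih, ← iL_mul_iR, map_list_prod, List.map_ofFn]
    rfl

lemma tmulT_mul (n : ℕ) (x x' : H) (y y' : Tpow k H n) :
    tmulT k H n x y * tmulT k H n x' y' = tmulT k H n (x * x') (y * y') :=
  Algebra.TensorProduct.tmul_mul_tmul (R := k) x x' y y'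

lemma nest_mul (n : ℕ) (f g : Fin (n + 1) → H) : nest k H n (f * g) = nest k H n f * nest k H n g := by
  induction n with
  | zero => rfl
  | succ n ih =>
    rw [nest_succ, nest_succ, nest_succ, tmulT_mul, ← ih]; rfl

lemma nest_one (n : ℕ) : nest k H n 1 = 1 := by
  induction n with
  | zero => rfl
  | succ n ih =>
    rw [nest_succ]
    change tmulT k H n 1 (nest k H n 1) = 1
    rw [ih]; rfl

variable (k H) in
def PhiT (n : ℕ) : PT k H (n + 1) →ₐ[k] Tpow k H n :=
  PiTensorProduct.liftAlgHom (nestM k H n) (by rw [nestM_apply, nest_one])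
    (by intro x y; rw [nestM_apply, nestM_apply, nestM_apply, nest_mul])

lemma PhiT_tp (n : ℕ) (f : Fin (n + 1) → H) : PhiT k H n (tp k H f) = nest k H n f := by
  rw [← nestM_apply]
  exact PiTensorProduct.lift.tprod _

lemma PhiT_pl (n : ℕ) (i : Fin (n + 1)) : (PhiT k H n).comp (pl k H (n + 1) i) = tl k H n i := by
  ext x
  rw [AlgHom.comp_apply, pl_apply, PhiT_tp]
  induction n with
  | zero =>
    obtain rfl : i = 0 := Fin.fin_one_eq_zero i
    exact Pi.mulSingle_eq_same _ _
  | succ n ih =>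
    rw [nest_succ]
    refine Fin.cases ?_ (fun j => ?_) i
    · rw [Pi.mulSingle_eq_same]
      have : (fun i : Fin (n+1) => Pi.mulSingle (M := fun _ => H) (0 : Fin (n+2)) x i.succ) = 1 := by
        ext i; simp [Pi.mulSingle_apply]
      rw [this, nest_one]; rfl
    · have : (fun i : Fin (n+1) => Pi.mulSingle (M := fun _ => H) (j.succ : Fin (n+2)) x i.succ)
          = Pi.mulSingle j x := by
        ext i; simp [Pi.mulSingle_apply]
      rw [this, ih]
      simp [Pi.mulSingle_apply, (Fin.succ_ne_zero j).symm]
      rfl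

variable (k H) in
def PL (m : ℕ) : List (H →ₐ[k] PT k H m) := List.ofFn (pl k H m)

lemma PL_map (n : ℕ) : (PL k H (n + 1)).map (PhiT k H n).comp = legs k H n := by
  rw [PL, legs, List.map_ofFn]
  congr 1
  ext1 i
  exact PhiT_pl n i

lemma pl_cm (m : ℕ) {i j : Fin m} (h : i ≠ j) : cm (pl k H m i) (pl k H m j) := by
  intro x y
  rw [pl_apply, pl_apply, Commute, SemiconjBy, PiTensorProduct.tprod_mul_tprod,
    PiTensorProduct.tprod_mul_tprod, (Pi.mulSingle_commute (f := fun _ => H) h x y).eq]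

lemma PL_pw (m : ℕ) : (PL k H m).Pairwise cm := by
  rw [PL, List.pairwise_ofFn]
  intro i j h
  exact pl_cm m h.ne

lemma PhiT_DD (n : ℕ) (x : H) : PhiT k H n (DD (PL k H (n+1)) x) = comulIter k H n x := by
  rw [comulIter_eq, ← PL_map, DD_map _ (PL_pw _)]; rfl

lemma PhiT_DDF {F G : H ⊗[k] H} (c : Coc F G) (n : ℕ) (x : H) :
    PhiT k H n (FF F (PL k H (n+1)) * DD (PL k H (n+1)) x * FI G (PL k H (n+1))) =
      comulIterF k H F G n x := by
  rw [comulIterF_eq c, ← PL_map, DD_map _ (PL_pw _), FF_map _ _ (PL_pw _), FI_map _ _ (PL_pw _),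
    map_mul, map_mul]; rfl

/-- finite sum representation -/
lemma exists_sum_tp {m : ℕ} (hm : 0 < m) (X : PT k H m) :
    ∃ (r : ℕ) (L : Fin r → Fin m → H), X = ∑ i, tp k H (L i) := by
  induction X using PiTensorProduct.induction_on with
  | smul_tprod r f =>
    refine ⟨1, fun _ => Function.update f ⟨0, hm⟩ (r • f ⟨0, hm⟩), ?_⟩
    rw [Fin.sum_univ_one, MultilinearMap.map_update_smul, Function.update_eq_self]
  | add x y hx hy =>
    obtain ⟨a, L, rfl⟩ := hx
    obtain ⟨b, M, rfl⟩ := hy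
    refine ⟨a + b, Fin.append L M, ?_⟩
    rw [Fin.sum_univ_add]
    simp

variable (k H) in
def msig {m : ℕ} (σ : Equiv.Perm (Fin m)) : PT k H m →ₗ[k] H :=
  PiTensorProduct.lift ((MultilinearMap.mkPiAlgebraFin k m H).domDomCongr σ)

lemma msig_tp {m : ℕ} (σ : Equiv.Perm (Fin m)) (f : Fin m → H) :
    msig k H σ (tp k H f) = (List.ofFn fun t => f (σ t)).prod := by
  rw [msig, PiTensorProduct.lift.tprod]
  simp
end bridge

section gaps
variable {m : ℕ} (σ : Equiv.Perm (Fin m))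

variable (k H) in
def betM : MultilinearMap k (fun _ : Fin m => H) (PT k H (m + 1)) :=
  ((tp k H (m := m + 1)).curryLeft (1 : H)).domDomCongr σ

lemma betM_apply (b : Fin m → H) :
    betM k H σ b = tp k H (Fin.cons (1 : H) (fun t => b (σ t)) : Fin (m + 1) → H) := rfl

variable (k H) in
def alpM : MultilinearMap k (fun _ : Fin m => H) (PT k H (m + 1)) :=
  ((LinearMap.applyₗ (1 : H)).compMultilinearMap
    ((tp k H (m := m + 1)).curryRight)).domDomCongr σ

lemma alpM_apply (b : Fin m → H) :
    alpM k H σ b = tp k H (Fin.snoc (fun t => b (σ t)) (1 : H) : Fin (m + 1) → H) := rfl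

lemma tp_one : tp k H (1 : Fin m → H) = 1 := rfl

lemma tp_mul (a b : Fin m → H) : tp k H a * tp k H b = tp k H (a * b) :=
  PiTensorProduct.tprod_mul_tprod a b

variable (k H) in
def bet : PT k H m →ₐ[k] PT k H (m + 1) :=
  PiTensorProduct.liftAlgHom (betM k H σ)
    (by
      rw [betM_apply, ← tp_one]; congr 1
      ext i; refine Fin.cases ?_ (fun j => ?_) i <;> simp)
    (by
      intro x y
      rw [betM_apply, betM_apply, betM_apply, tp_mul]; congr 1
      ext i; refine Fin.cases ?_ (fun j => ?_) i <;> simp)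

variable (k H) in
def alp : PT k H m →ₐ[k] PT k H (m + 1) :=
  PiTensorProduct.liftAlgHom (alpM k H σ)
    (by
      rw [alpM_apply, ← tp_one]; congr 1
      ext i; refine Fin.lastCases ?_ (fun j => ?_) i <;> simp)
    (by
      intro x y
      rw [alpM_apply, alpM_apply, alpM_apply, tp_mul]; congr 1
      ext i; refine Fin.lastCases ?_ (fun j => ?_) i <;> simp)

lemma bet_tp (b : Fin m → H) : bet k H σ (tp k H b) =
    tp k H (Fin.cons (1 : H) (fun t => b (σ t)) : Fin (m + 1) → H) :=
  PiTensorProduct.lift.tprod _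

lemma alp_tp (b : Fin m → H) : alp k H σ (tp k H b) =
    tp k H (Fin.snoc (fun t => b (σ t)) (1 : H) : Fin (m + 1) → H) :=
  PiTensorProduct.lift.tprod _

lemma bet_pl (j : Fin m) : (bet k H σ).comp (pl k H m j) = pl k H (m + 1) (σ.symm j).succ := by
  ext x
  rw [AlgHom.comp_apply, pl_apply, pl_apply, bet_tp]
  congr 1
  ext i
  refine Fin.cases ?_ (fun t => ?_) i
  · simp [Pi.mulSingle_apply, (Fin.succ_ne_zero _).symm]
  · simp [Pi.mulSingle_apply, Equiv.eq_symm_apply]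

lemma alp_pl (j : Fin m) : (alp k H σ).comp (pl k H m j) = pl k H (m + 1) (σ.symm j).castSucc := by
  ext x
  rw [AlgHom.comp_apply, pl_apply, pl_apply, alp_tp]
  congr 1
  ext i
  refine Fin.lastCases ?_ (fun t => ?_) i
  · simp [Pi.mulSingle_apply, (Fin.castSucc_lt_last _).ne']
  · simp [Pi.mulSingle_apply, Equiv.eq_symm_apply]

lemma gap_list (b' a' : H) (a b w : Fin m → H) (y : Fin (m + 1) → H)
    (hy : ∀ i, y i = (Fin.cons b' b : Fin (m + 1) → H) i * (Fin.snoc a a' : Fin (m + 1) → H) i) :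
    y 0 * (List.ofFn fun t : Fin m => w t * y t.succ).prod =
      b' * (List.ofFn fun t => a t * w t * b t).prod * a' := by
  induction m generalizing b' with
  | zero =>
    rw [hy]; simp [Fin.snoc]
  | succ m ih =>
    have h := ih (b 0) (fun i => a i.succ) (fun i => b i.succ) (fun i => w i.succ) (fun i => y i.succ)
      (by
        intro i
        rw [hy, Fin.cons_succ]
        congr 1
        · refine Fin.cases ?_ (fun j => ?_) i <;> simp
        · refine Fin.lastCases ?_ (fun j => ?_) i
          · rw [Fin.succ_last, Fin.snoc_last, Fin.snoc_last]
          · rw [Fin.succ_castSucc, Fin.snoc_castSucc, Fin.snoc_castSucc])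
    rw [List.ofFn_succ, List.prod_cons, List.ofFn_succ, List.prod_cons, mul_assoc (w 0), h, hy 0]
    have : (Fin.snoc a a' : Fin (m + 2) → H) 0 = a 0 := by
      have := Fin.snoc_castSucc (α := fun _ => H) a' a 0
      simpa using this
    rw [this, Fin.cons_zero]
    simp only [mul_assoc]

variable (k H) in
def gapM (x : Fin m → H) : PT k H (m + 1) →ₗ[k] H :=
  PiTensorProduct.lift ((MultilinearMap.mkPiAlgebraFin k (m + 1) H).compLinearMap
    (Fin.cons LinearMap.id (fun t => LinearMap.mulLeft k (x (σ t)))))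

lemma gapM_tp (x : Fin m → H) (y : Fin (m + 1) → H) : gapM k H σ x (tp k H y) =
    y 0 * (List.ofFn fun t : Fin m => x (σ t) * y t.succ).prod := by
  rw [gapM, PiTensorProduct.lift.tprod]
  simp [List.ofFn_succ]

lemma gap_claim_pure (x a b : Fin m → H) (b' a' : H) :
    gapM k H σ x (pl k H (m + 1) 0 b' * bet k H σ (tp k H b) *
      (alp k H σ (tp k H a) * pl k H (m + 1) (Fin.last m) a')) =
      b' * msig k H σ (tp k H a * tp k H x * tp k H b) * a' := by
  rw [pl_apply, pl_apply, bet_tp, alp_tp, tp_mul, tp_mul, tp_mul, tp_mul, tp_mul, msig_tp, gapM_tp]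
  refine gap_list b' a' (fun t => a (σ t)) (fun t => b (σ t)) (fun t => x (σ t)) _ ?_
  intro i
  rw [Pi.mul_apply]
  congr 1
  · refine Fin.cases ?_ (fun j => ?_) i
    · simp
    · simp [Pi.mulSingle_apply]
  · refine Fin.lastCases ?_ (fun j => ?_) i
    · simp
    · simp [Pi.mulSingle_apply, (Fin.castSucc_lt_last _).ne]

lemma gap_claim (x : Fin m → H) (A B : PT k H m) (b' a' : H) :
    gapM k H σ x (pl k H (m + 1) 0 b' * bet k H σ B *
      (alp k H σ A * pl k H (m + 1) (Fin.last m) a')) =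
      b' * msig k H σ (A * tp k H x * B) * a' := by
  induction A using PiTensorProduct.induction_on with
  | smul_tprod r a =>
    induction B using PiTensorProduct.induction_on with
    | smul_tprod s b =>
      have := gap_claim_pure (k := k) σ x a b b' a'
      simp only [map_smul, smul_mul_assoc, mul_smul_comm, this]
      exact smul_comm r s _
    | add B B' hB hB' => simp only [map_add, mul_add, add_mul, hB, hB']
  | add A A' hA hA' => simp only [map_add, mul_add, add_mul, hA, hA']

lemma gapM_one (x : Fin m → H) : gapM k H σ x 1 = msig k H σ (tp k H x) := by
  have := gap_claim (k := k) σ x 1 1 1 1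
  simpa using this

variable {σ}
lemma Coc.core {F G : H ⊗[k] H} (c : Coc F G) (hvu : vv G * uu F = 1) (p q : ℕ)
    (h1 : pl k H (m + 1) 0 :: ((PL k H m).take q).map (bet k H σ).comp =
      ((PL k H m).drop p).map (alp k H σ).comp ++ [pl k H (m + 1) (Fin.last m)])
    (h2 : ((PL k H m).drop q).map (bet k H σ).comp = ((PL k H m).take p).map (alp k H σ).comp)
    {r s : ℕ} (f1 f2 : Fin r → H) (g1 g2 : Fin s → H) (hF : F = ∑ i, f1 i ⊗ₜ f2 i)
    (hG : G = ∑ i, g1 i ⊗ₜ g2 i) (X : PT k H m) :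
    ∑ j, ∑ i, g1 j * msig k H σ ((FF F ((PL k H m).take p) * DD ((PL k H m).take p) (uu F) *
        FF F ((PL k H m).drop p) * DD ((PL k H m).drop p) (f1 i)) * X *
      (DD ((PL k H m).take q) (g2 j) * FI G ((PL k H m).take q) *
        DD ((PL k H m).drop q) (vv G) * FI G ((PL k H m).drop q))) * f2 i = msig k H σ X := by
  have hpw := PL_pw (k := k) (H := H) m
  have pt := fun t => hpw.sublist (List.take_sublist t _)
  have pd := fun t => hpw.sublist (List.drop_sublist t _)
  induction X using PiTensorProduct.induction_on with
  | smul_tprod a x =>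
    simp only [map_smul, smul_mul_assoc, mul_smul_comm, ← Finset.smul_sum]
    congr 1
    simp only [← gap_claim, ← map_sum]
    rw [← gapM_one]
    congr 1
    have hp : (pl k H (m + 1) 0 :: ((PL k H m).take q).map (bet k H σ).comp).Pairwise cm := by
      rw [List.pairwise_cons]
      refine ⟨?_, pw_map _ (pt q)⟩
      intro φ hφ
      obtain ⟨ψ, hψ, rfl⟩ := List.mem_map.1 hφ
      obtain ⟨j, rfl⟩ := (List.mem_ofFn).1 (List.mem_of_mem_take hψ)
      rw [bet_pl]
      exact pl_cm _ (Fin.succ_ne_zero _).symm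
    have key := c.gapside h1 hp hvu (C := ((PL k H m).drop q).map (bet k H σ).comp)
    rw [← key]
    have eG : le (pl k H (m + 1) 0).toLinearMap
        (DD (((PL k H m).take q).map (bet k H σ).comp)).toLinearMap G =
        ∑ j, pl k H (m + 1) 0 (g1 j) * bet k H σ (DD ((PL k H m).take q) (g2 j)) := by
      conv_lhs => rw [hG]
      rw [map_sum, DD_map _ (pt q)]
      rfl
    have eF : le (DD (((PL k H m).drop p).map (alp k H σ).comp)).toLinearMap
        (pl k H (m + 1) (Fin.last m)).toLinearMap F =
        ∑ i, alp k H σ (DD ((PL k H m).drop p) (f1 i)) * pl k H (m + 1) (Fin.last m) (f2 i) := by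
      conv_lhs => rw [hF]
      rw [map_sum, DD_map _ (pd p)]
      rfl
    rw [eG, eF, FI_map _ _ (pt q), FI_map _ _ (pd q), FF_map _ _ (pd p)]
    have e1 : DD (((PL k H m).drop q).map (bet k H σ).comp) (vv G) =
        bet k H σ (DD ((PL k H m).drop q) (vv G)) := by rw [DD_map _ (pd q)]; rfl
    have e2 : DD (((PL k H m).drop q).map (bet k H σ).comp) (uu F) =
        alp k H σ (DD ((PL k H m).take p) (uu F)) := by rw [h2, DD_map _ (pt p)]; rfl
    rw [e1, e2, h2, FF_map _ _ (pt p)]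
    simp only [Finset.sum_mul, Finset.mul_sum, map_mul, mul_assoc]
    rw [Finset.sum_comm]
  | add X Y hX hY =>
    simp only [map_add, mul_add, add_mul, Finset.sum_add_distrib, hX, hY]
end gaps

section arith
variable {m : ℕ} {σ : Equiv.Perm (Fin m)} {l : ℕ}

lemma sig_zero (hl : 1 ≤ l) (hlm : l ≤ m)
    (hσ : ∀ t : Fin m, (σ t : ℕ) = (((t : ℕ) + 1) * l + (m + 1) - 1) % (m + 1))
    (i : Fin m) (hi : (i : ℕ) + 1 = l) : (σ.symm i : ℕ) = 0 := by
  have h0 : 0 < m := by omega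
  have : σ ⟨0, h0⟩ = i := by
    apply Fin.ext
    rw [hσ]
    have : (0 + 1) * l + (m + 1) - 1 = (l - 1) + (m + 1) := by omega
    simp only [this]
    rw [Nat.add_mod_right, Nat.mod_eq_of_lt (by omega)]
    omega
  rw [← this, Equiv.symm_apply_apply]

lemma sig_last (hl : 1 ≤ l) (hlm : l ≤ m)
    (hσ : ∀ t : Fin m, (σ t : ℕ) = (((t : ℕ) + 1) * l + (m + 1) - 1) % (m + 1))
    (t : Fin m) : (t : ℕ) + 1 = m ↔ (σ t : ℕ) + l = m := by
  have key : ∀ t : Fin m, (t : ℕ) + 1 = m → (σ t : ℕ) + l = m := by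
    intro t ht
    have h1 : ((σ t : ℕ) + l) % (m + 1) = m := by
      rw [hσ, Nat.mod_add_mod, ht]
      have : m * l + (m + 1) - 1 + l = m + (m + 1) * l := by
        rw [Nat.add_mul]; omega
      rw [this, Nat.add_mul_mod_self_left, Nat.mod_eq_of_lt (by omega)]
    have h2 := (σ t).2
    by_cases h : (σ t : ℕ) + l < m + 1
    · rwa [Nat.mod_eq_of_lt h] at h1
    · rw [Nat.mod_eq_sub_mod (by omega), Nat.mod_eq_of_lt (by omega)] at h1
      omega
  refine ⟨key t, fun h => ?_⟩
  have h0 : m - 1 < m := by omega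
  have h1 := key ⟨m - 1, h0⟩ (by simp; omega)
  have : σ t = σ ⟨m - 1, h0⟩ := Fin.ext (by omega)
  have := congrArg Fin.val (σ.injective this)
  simp at this
  omega

lemma sig_step
    (hσ : ∀ t : Fin m, (σ t : ℕ) = (((t : ℕ) + 1) * l + (m + 1) - 1) % (m + 1))
    (t t' : Fin m) (h : (t' : ℕ) = t + 1) : (σ t' : ℕ) = ((σ t : ℕ) + l) % (m + 1) := by
  rw [hσ, hσ, Nat.mod_add_mod, h]
  congr 1
  rw [Nat.add_mul (t + 1 : ℕ) 1 l]
  omega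

lemma sig_move (hl : 1 ≤ l) (hlm : l ≤ m)
    (hσ : ∀ t : Fin m, (σ t : ℕ) = (((t : ℕ) + 1) * l + (m + 1) - 1) % (m + 1))
    (j i : Fin m) (h : (i : ℕ) = j + l ∨ (i : ℕ) + (m + 1) = j + l) :
    (σ.symm j).succ = (σ.symm i).castSucc := by
  have hj : σ (σ.symm j) = j := σ.apply_symm_apply j
  have hlast := sig_last hl hlm hσ (σ.symm j)
  rw [hj] at hlast
  have h1 : (σ.symm j : ℕ) + 1 < m := by
    have := (σ.symm j).2
    have h2 : ¬ ((j : ℕ) + l = m) := by omega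
    have h3 := mt hlast.1 h2
    omega
  have hs := sig_step hσ (σ.symm j) ⟨_, h1⟩ rfl
  rw [hj] at hs
  have : σ ⟨_, h1⟩ = i := by
    apply Fin.ext
    rw [hs]
    rcases h with h | h
    · rw [Nat.mod_eq_of_lt (by omega), h]
    · rw [← h, Nat.add_mod_right, Nat.mod_eq_of_lt (by omega)]
  rw [← this, Equiv.symm_apply_apply]
  rfl

lemma list1 (hl : 1 ≤ l) (hlm : l ≤ m)
    (hσ : ∀ t : Fin m, (σ t : ℕ) = (((t : ℕ) + 1) * l + (m + 1) - 1) % (m + 1)) :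
    pl k H (m + 1) 0 :: ((PL k H m).take (m + 1 - l)).map (bet k H σ).comp =
      ((PL k H m).drop (l - 1)).map (alp k H σ).comp ++ [pl k H (m + 1) (Fin.last m)] := by
  have hlen : (PL k H m).length = m := by simp [PL]
  apply List.ext_getElem
  · simp [hlen]; omega
  · intro t ht1 ht2
    have ht : t < m + 1 - l + 1 := by
      simp [hlen] at ht1; omega
    rw [List.getElem_append]
    simp only [List.length_map, List.length_drop, hlen]
    rcases t with _ | t
    · rw [dif_pos (by omega)]
      simp only [List.getElem_cons_zero, List.getElem_map, List.getElem_drop, PL, List.getElem_ofFn,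
        alp_pl]
      congr 1
      apply Fin.ext
      exact (sig_zero hl hlm hσ _ (by simp; omega)).symm
    · simp only [List.getElem_cons_succ, List.getElem_map, List.getElem_drop, PL, List.getElem_ofFn,
        List.getElem_take, alp_pl, bet_pl]
      split_ifs with h
      · congr 1
        exact sig_move hl hlm hσ _ _ (by simp; omega)
      · simp only [List.getElem_singleton]
        congr 1
        apply Fin.ext
        have := (sig_last hl hlm hσ (σ.symm ⟨t, by omega⟩)).2
          (by rw [Equiv.apply_symm_apply]; simp; omega)
        simpa using this

lemma list2 (hl : 1 ≤ l) (hlm : l ≤ m)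
    (hσ : ∀ t : Fin m, (σ t : ℕ) = (((t : ℕ) + 1) * l + (m + 1) - 1) % (m + 1)) :
    ((PL k H m).drop (m + 1 - l)).map (bet k H σ).comp =
      ((PL k H m).take (l - 1)).map (alp k H σ).comp := by
  have hlen : (PL k H m).length = m := by simp [PL]
  apply List.ext_getElem
  · simp [hlen]; omega
  · intro t ht1 ht2
    simp only [List.length_map, List.length_drop, hlen] at ht1
    simp only [List.getElem_map, List.getElem_drop, PL, List.getElem_ofFn,
        List.getElem_take, alp_pl, bet_pl]
    congr 1
    exact sig_move hl hlm hσ _ _ (by simp; omega)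
end arith

lemma vu_of_uv [FiniteDimensional k H] {u v : H} (h : u * v = 1) : v * u = 1 := by
  have h1 : LinearMap.mulLeft k u * LinearMap.mulLeft k v = 1 := by
    ext x; simp [← mul_assoc, h]
  have h2 := mul_eq_one_comm.1 h1
  have := DFunLike.congr_fun h2 (1 : H)
  simpa using this

lemma tr_move [FiniteDimensional k H] (T : H →ₗ[k] H) (a b : H) :
    LinearMap.trace k H (LinearMap.mulRight k b ∘ₗ LinearMap.mulLeft k a ∘ₗ T) =
    LinearMap.trace k H (T ∘ₗ (LinearMap.mulRight k b ∘ₗ LinearMap.mulLeft k a)) := by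
  rw [← LinearMap.comp_assoc, LinearMap.trace_comp_comm']

lemma Coc.main [FiniteDimensional k H] {F G : H ⊗[k] H} (c : Coc F G) {m l : ℕ}
    {σ : Equiv.Perm (Fin m)} (hl : 1 ≤ l) (hlm : l ≤ m)
    (hσ : ∀ t : Fin m, (σ t : ℕ) = (((t : ℕ) + 1) * l + (m + 1) - 1) % (m + 1))
    (P PF : H →ₗ[k] H) (hP : ∀ x, P x = msig k H σ (DD (PL k H m) x))
    (hPF : ∀ x, PF x = msig k H σ (FF F (PL k H m) * DD (PL k H m) x * FI G (PL k H m))) :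
    LinearMap.trace k H (LinearMap.mulRight k (vv G) ∘ₗ LinearMap.mulLeft k (uu F) ∘ₗ
      (HopfAlgebra.antipode k ∘ₗ PF)) = LinearMap.trace k H (HopfAlgebra.antipode k ∘ₗ P) := by
  have hvu : vv G * uu F = 1 := vu_of_uv (k := k) c.uv
  obtain ⟨r, f1, f2, hF⟩ := TensorProduct.exists_sum_tmul_eq F
  obtain ⟨s, g1, g2, hG⟩ := TensorProduct.exists_sum_tmul_eq G
  have hcore := c.core hvu _ _ (list1 (k := k) (H := H) hl hlm hσ) (list2 hl hlm hσ)
    f1 f2 g1 g2 hF hG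
  have hA := c.Aside (l₁ := (PL k H m).take (l - 1)) (l₂ := (PL k H m).drop (l - 1))
    (by rw [List.take_append_drop]; exact PL_pw m)
  have hB := c.Bside (l₁ := (PL k H m).take (m + 1 - l)) (l₂ := (PL k H m).drop (m + 1 - l))
    (by rw [List.take_append_drop]; exact PL_pw m)
  rw [List.take_append_drop] at hA hB
  set Cf : Fin r → PT k H m := fun i => FF F ((PL k H m).take (l - 1)) *
    DD ((PL k H m).take (l - 1)) (uu F) *
        FF F ((PL k H m).drop (l - 1)) * DD ((PL k H m).drop (l - 1)) (f1 i) with hCf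
  set Cg : Fin s → PT k H m := fun j => DD ((PL k H m).take (m + 1 - l)) (g2 j) *
    FI G ((PL k H m).take (m + 1 - l)) *
        DD ((PL k H m).drop (m + 1 - l)) (vv G) * FI G ((PL k H m).drop (m + 1 - l)) with hCg
  have hA' : FF F (PL k H m) * DD (PL k H m) (uu F) =
      ∑ i, Cf i * DD (PL k H m) (HopfAlgebra.antipode k (f2 i)) := by
    rw [hA]
    have : ∀ (φ : H →ₐ[k] PT k H m) (ψ : H →ₗ[k] PT k H m), le φ.toLinearMap ψ F =
      ∑ i, φ (f1 i) * ψ (f2 i) := by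
      intro φ ψ; rw [hF, map_sum]; rfl
    rw [this, Finset.mul_sum]
    refine Finset.sum_congr rfl fun i _ => ?_
    rw [hCf, ← mul_assoc]; rfl
  have hB' : DD (PL k H m) (vv G) * FI G (PL k H m) =
      ∑ j, DD (PL k H m) (HopfAlgebra.antipode k (g1 j)) * Cg j := by
    rw [hB]
    have : ∀ (φ : H →ₐ[k] PT k H m) (ψ : H →ₗ[k] PT k H m), le ψ φ.toLinearMap G =
      ∑ i, ψ (g1 i) * φ (g2 i) := by
      intro φ ψ; rw [hG, map_sum]; rfl
    rw [this, Finset.sum_mul, Finset.sum_mul, Finset.sum_mul]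
    refine Finset.sum_congr rfl fun i _ => ?_
    simp only [hCg, mul_assoc]; rfl
  let Q : Fin s → Fin r → (H →ₗ[k] H) := fun j i =>
    msig k H σ ∘ₗ LinearMap.mulRight k (Cg j) ∘ₗ LinearMap.mulLeft k (Cf i) ∘ₗ
      (DD (PL k H m)).toLinearMap
  have hQ : ∀ j i x, Q j i x = msig k H σ (Cf i * DD (PL k H m) x * Cg j) := fun _ _ _ => rfl
  rw [tr_move]
  have e1 : (HopfAlgebra.antipode k ∘ₗ PF) ∘ₗ
      (LinearMap.mulRight k (vv G) ∘ₗ LinearMap.mulLeft k (uu F)) =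
      ∑ j, ∑ i, (HopfAlgebra.antipode k ∘ₗ Q j i) ∘ₗ
        (LinearMap.mulRight k (HopfAlgebra.antipode k (g1 j)) ∘ₗ
          LinearMap.mulLeft k (HopfAlgebra.antipode k (f2 i))) := by
    ext h
    simp only [LinearMap.sum_apply, LinearMap.comp_apply, LinearMap.mulRight_apply,
      LinearMap.mulLeft_apply, hPF, hQ, ← map_sum]
    congr 2
    have : FF F (PL k H m) * DD (PL k H m) (uu F * h * vv G) * FI G (PL k H m) =
        (FF F (PL k H m) * DD (PL k H m) (uu F)) * DD (PL k H m) h *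
          (DD (PL k H m) (vv G) * FI G (PL k H m)) := by
      simp only [map_mul, mul_assoc]
    rw [this, hA', hB', Finset.mul_sum]
    refine Finset.sum_congr rfl fun j _ => ?_
    rw [Finset.sum_mul, Finset.sum_mul]
    refine Finset.sum_congr rfl fun i _ => ?_
    simp only [map_mul, mul_assoc]
  rw [e1]
  simp only [map_sum, ← tr_move]
  simp only [← map_sum]
  congr 1
  ext h
  simp only [LinearMap.sum_apply, LinearMap.comp_apply, LinearMap.mulRight_apply,
      LinearMap.mulLeft_apply, hP]
  rw [← hcore, map_sum]
  refine Finset.sum_congr rfl fun j _ => ?_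
  rw [map_sum]
  refine Finset.sum_congr rfl fun i _ => ?_
  rw [anti_mul, anti_mul, hQ, mul_assoc]

end FSI

theorem statement13
    (k H : Type) [Field k] [Ring H] [HopfAlgebra k H] [FiniteDimensional k H]
    (S : H →ₗ[k] H) (hS : S = HopfAlgebra.antipode (R := k))
    -- the 2-cocycle F with inverse F' :
    (F F' : H ⊗[k] H)
    (hinv₁ : F * F' = 1) (hinv₂ : F' * F = 1)
    (hcu₁ : (TensorProduct.lid k H)
      ((TensorProduct.map (Coalgebra.counit (R := k)) LinearMap.id) F) = 1)
    (hcu₂ : (TensorProduct.rid k H)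
      ((TensorProduct.map LinearMap.id (Coalgebra.counit (R := k))) F) = 1)
    (hcoc : ((1 : H) ⊗ₜ[k] F) *
        (TensorProduct.map LinearMap.id (Coalgebra.comul (R := k)) F) =
      (TensorProduct.assoc k H H H)
        ((F ⊗ₜ[k] (1 : H)) *
          (TensorProduct.map (Coalgebra.comul (R := k)) LinearMap.id F)))
    -- the Drinfeld element and the twisted antipode S_F = u S(−) u⁻¹ :
    (u : H) (hu : u = LinearMap.mul' k H ((TensorProduct.map LinearMap.id S) F))
    (SF : H →ₗ[k] H)
    (hSF : SF = (LinearMap.mulRight k (Ring.inverse u)) ∘ₗ (LinearMap.mulLeft k u) ∘ₗ S)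
    -- coprime integers n > 1 and l :
    (n l : ℕ) (hn : 1 < n) (hcop : Nat.Coprime n l)
    -- the permutation σ_{(n,l)} ∈ Sym_{n-1}, σ(i) = il mod n (least positive residues,
    -- written 0-based on Fin (n-1) = Fin (n-2+1)) :
    (σ : Equiv.Perm (Fin (n - 2 + 1)))
    (hσ : ∀ t : Fin (n - 2 + 1), (σ t : ℕ) = (((t : ℕ) + 1) * l + n - 1) % n)
    -- P̃^{(n,l)} = m ∘ σ_{(n,l)} ∘ Δ^{n-1}, characterized on finite-sum
    -- representations of Δ^{n-1} :
    (P : H →ₗ[k] H)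
    (hP : ∀ (x : H) (m : ℕ) (L : Fin m → Fin (n - 2 + 1) → H),
      comulIter k H (n - 2) x = ∑ i, nest k H (n - 2) (L i) →
      P x = ∑ i, (List.ofFn (fun t : Fin (n - 2 + 1) => L i (σ t))).prod)
    -- P̃_F^{(n,l)} = m ∘ σ_{(n,l)} ∘ Δ_F^{n-1} for the twist H_F :
    (PF : H →ₗ[k] H)
    (hPF : ∀ (x : H) (m : ℕ) (L : Fin m → Fin (n - 2 + 1) → H),
      comulIterF k H F F' (n - 2) x = ∑ i, nest k H (n - 2) (L i) →
      PF x = ∑ i, (List.ofFn (fun t : Fin (n - 2 + 1) => L i (σ t))).prod) :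
    LinearMap.trace k H (SF ∘ₗ PF) = LinearMap.trace k H (S ∘ₗ P) := by
  subst hS
  have c : Coc F F' := ⟨hinv₁, hinv₂, hcu₁, hcu₂, hcoc⟩
  have hu' : u = uu F := hu
  have hvu : vv F' * uu F = 1 := vu_of_uv (k := k) c.uv
  have hinv : Ring.inverse u = vv F' := by
    rw [hu']
    exact Ring.inverse_unit (⟨uu F, vv F', c.uv, hvu⟩ : Hˣ)
  have hm : n - 2 + 1 + 1 = n := by omega
  have hl1 : 1 ≤ l % n := by
    rcases Nat.eq_zero_or_pos (l % n) with h | h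
    · have h1 : n ∣ l := Nat.dvd_of_mod_eq_zero h
      have h2 := Nat.Coprime.eq_one_of_dvd hcop h1
      omega
    · exact h
  have hl2 : l % n ≤ n - 2 + 1 := by
    have := Nat.mod_lt l (show 0 < n by omega)
    omega
  have hσ' : ∀ t : Fin (n - 2 + 1), (σ t : ℕ) =
      (((t : ℕ) + 1) * (l % n) + (n - 2 + 1 + 1) - 1) % (n - 2 + 1 + 1) := by
    intro t
    rw [hσ, hm, Nat.add_sub_assoc (by omega), Nat.add_sub_assoc (by omega)]
    exact Nat.ModEq.add_right _ (Nat.ModEq.mul_left _ (Nat.mod_modEq l n).symm)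
  have hP' : ∀ x, P x = msig k H σ (DD (PL k H (n - 2 + 1)) x) := by
    intro x
    obtain ⟨r, L, hL⟩ := exists_sum_tp (Nat.succ_pos _) (DD (PL k H (n - 2 + 1)) x)
    rw [hP x r L, hL, map_sum]
    · simp only [msig_tp]
    · rw [← PhiT_DD, hL, map_sum]
      simp only [PhiT_tp]
  have hPF' : ∀ x, PF x = msig k H σ (FF F (PL k H (n - 2 + 1)) * DD (PL k H (n - 2 + 1)) x *
      FI F' (PL k H (n - 2 + 1))) := by
    intro x
    obtain ⟨r, L, hL⟩ := exists_sum_tp (Nat.succ_pos _) (FF F (PL k H (n - 2 + 1)) *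
      DD (PL k H (n - 2 + 1)) x * FI F' (PL k H (n - 2 + 1)))
    rw [hPF x r L, hL, map_sum]
    · simp only [msig_tp]
    · rw [← PhiT_DDF c, hL, map_sum]
      simp only [PhiT_tp]
  rw [hSF, hinv, hu']
  exact c.main hl1 hl2 hσ' P PF hP' hPF'
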